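/- arXiv:2002.08517 — 5 statements merged into one kernel-verified Lean document; each statement's English description precedes it below -/
import Mathlib

section
/- Let σ_w, σ_b ≥ 0, s1, s2 > 0 and ρ ∈ [-1,1]. Then σ_b² + σ_w² · s1·s2 · E[Z1·Z2·Φ(s1·Z1)·Φ(s2·Z2)] = σ_b² + σ_w² · ( (s1·s2/4)·ρ + (s1²·s2²/(2π)) · [ (ρ² + 1 + s1² + s2² + s1²·s2²·(1−ρ²)) / ((1+s1²)·(1+s2²)·√(1 + s1² + s2² + s1²·s2²·(1−ρ²))) + (ρ/(s1·s2)) · arctan( ρ·s1·s2 / √(1 + s1² + s2² + s1²·s2²·(1−ρ²)) ) ] ). (This is the closed-form covariance function of an infinitely wide one-hidden-layer network with GELU activation ψ(z) = z·Φ(z).) -/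
open Real MeasureTheory

/-- Standard Gaussian probability density function. -/
noncomputable def gpdf (x : ℝ) : ℝ := (Real.sqrt (2 * Real.pi))⁻¹ * Real.exp (-(x ^ 2) / 2)

/-- Standard Gaussian cumulative distribution function Φ. -/
noncomputable def gcdf (x : ℝ) : ℝ := ∫ t in Set.Iic x, gpdf t

/-! ### The standard Gaussian density and distribution function -/

lemma gpdf_eq_gaussianPDFReal : gpdf = ProbabilityTheory.gaussianPDFReal 0 1 := by
  ext x
  simp [gpdf, ProbabilityTheory.gaussianPDFReal]

lemma continuous_gpdf : Continuous gpdf := by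
  unfold gpdf
  fun_prop

lemma integrable_gpdf : Integrable gpdf :=
  gpdf_eq_gaussianPDFReal ▸ ProbabilityTheory.integrable_gaussianPDFReal 0 1

lemma integral_gpdf : ∫ x, gpdf x = 1 :=
  gpdf_eq_gaussianPDFReal ▸ ProbabilityTheory.integral_gaussianPDFReal_eq_one 0 one_ne_zero

lemma gpdf_nonneg (x : ℝ) : 0 ≤ gpdf x := by
  unfold gpdf
  positivity

lemma gpdf_neg (x : ℝ) : gpdf (-x) = gpdf x := by
  simp [gpdf]

lemma gpdf_le_one (x : ℝ) : gpdf x ≤ 1 := by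
  have h1 : (1 : ℝ) ≤ Real.sqrt (2 * Real.pi) :=
    Real.one_le_sqrt.2 (by linarith [Real.pi_gt_three])
  have h2 : Real.exp (-(x ^ 2) / 2) ≤ 1 := Real.exp_le_one_iff.2 (by nlinarith [sq_nonneg x])
  exact mul_le_one₀ (inv_le_one_of_one_le₀ h1) (Real.exp_nonneg _) h2

lemma gcdf_zero : gcdf 0 = 1 / 2 := by
  have h1 : gcdf 0 = ∫ t in Set.Ioi 0, gpdf t := by
    have := integral_comp_neg_Iic 0 gpdf
    simpa [gcdf, gpdf_neg] using this
  have h2 := integral_add_compl (measurableSet_Iic (a := (0 : ℝ))) integrable_gpdf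
  rw [Set.compl_Iic, integral_gpdf, ← h1] at h2
  change gcdf 0 + gcdf 0 = 1 at h2
  linarith

lemma hasDerivAt_gcdf (x : ℝ) : HasDerivAt gcdf (gpdf x) x := by
  have h : gcdf = fun x => gcdf 0 + ∫ t in (0 : ℝ)..x, gpdf t := by
    ext x
    rw [← intervalIntegral.integral_Iic_sub_Iic integrable_gpdf.integrableOn
      integrable_gpdf.integrableOn]
    simp [gcdf]
  rw [h]
  exact (intervalIntegral.integral_hasDerivAt_right
    (continuous_gpdf.intervalIntegrable _ _)
    (continuous_gpdf.stronglyMeasurableAtFilter _ _) continuous_gpdf.continuousAt).const_add _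

lemma continuous_gcdf : Continuous gcdf :=
  continuous_iff_continuousAt.2 fun x => (hasDerivAt_gcdf x).continuousAt

lemma gcdf_nonneg (x : ℝ) : 0 ≤ gcdf x :=
  integral_nonneg fun t => gpdf_nonneg t

lemma gcdf_le_one (x : ℝ) : gcdf x ≤ 1 := by
  rw [← integral_gpdf]
  exact setIntegral_le_integral integrable_gpdf (.of_forall gpdf_nonneg)

lemma norm_gpdf_le_one (x : ℝ) : ‖gpdf x‖ ≤ 1 := by
  rw [Real.norm_of_nonneg (gpdf_nonneg x)]
  exact gpdf_le_one x

lemma norm_gcdf_le_one (x : ℝ) : ‖gcdf x‖ ≤ 1 := by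
  rw [Real.norm_of_nonneg (gcdf_nonneg x)]
  exact gcdf_le_one x

/-- Differentiation under the integral sign in the scale parameter of `Φ(s·z)`. -/
lemma hasDerivAt_integral_mul_gcdf {α : Type*} [MeasurableSpace α] {μ : Measure α} {g z : α → ℝ}
    (hg : Integrable g μ) (hz : AEStronglyMeasurable z μ) (hgz : Integrable (fun a => g a * z a) μ)
    (s : ℝ) :
    HasDerivAt (fun s => ∫ a, g a * gcdf (s * z a) ∂μ)
      (∫ a, g a * z a * gpdf (s * z a) ∂μ) s := by
  have hΦ (t : ℝ) : AEStronglyMeasurable (fun a => gcdf (t * z a)) μ :=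
    continuous_gcdf.comp_aestronglyMeasurable (hz.const_mul t)
  have hφ (t : ℝ) : AEStronglyMeasurable (fun a => gpdf (t * z a)) μ :=
    continuous_gpdf.comp_aestronglyMeasurable (hz.const_mul t)
  refine (hasDerivAt_integral_of_dominated_loc_of_deriv_le (bound := fun a => ‖g a * z a‖)
    (F' := fun t a => g a * z a * gpdf (t * z a)) Filter.univ_mem
    (.of_forall fun t => hg.aestronglyMeasurable.mul (hΦ t)) ?_
    (hgz.aestronglyMeasurable.mul (hφ s)) (.of_forall fun a t _ => ?_) hgz.norm
    (.of_forall fun a t _ => ?_)).2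
  · exact hg.mul_bdd (hΦ s) (.of_forall fun a => norm_gcdf_le_one _)
  · rw [norm_mul]
    exact mul_le_of_le_one_right (norm_nonneg _) (norm_gpdf_le_one _)
  · have := ((hasDerivAt_gcdf (t * z a)).comp t ((hasDerivAt_id t).mul_const (z a))).const_mul (g a)
    convert! this using 1
    simp only [one_mul]
    ring

/-! ### Moments of centered Gaussians -/

lemma integrable_pow_mul_exp_neg_mul_sq (n : ℕ) {b : ℝ} (hb : 0 < b) :
    Integrable fun x : ℝ => x ^ n * Real.exp (-(b * x ^ 2) / 2) := by
  have := integrable_rpow_mul_exp_neg_mul_sq (half_pos hb) (s := n)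
    (by linarith [n.cast_nonneg (α := ℝ)])
  convert! this using 3 with x
  · rw [Real.rpow_natCast]
  · congr 1
    ring

lemma integral_pow_add_two_mul_exp_neg_mul_sq (n : ℕ) {b : ℝ} (hb : 0 < b) :
    ∫ x : ℝ, x ^ (n + 2) * Real.exp (-(b * x ^ 2) / 2) =
      (n + 1) / b * ∫ x : ℝ, x ^ n * Real.exp (-(b * x ^ 2) / 2) := by
  have hi (m : ℕ) := integrable_pow_mul_exp_neg_mul_sq m hb
  have h := integral_eq_zero_of_hasDerivAt_of_integrable
    (f := fun x : ℝ => x ^ (n + 1) * Real.exp (-(b * x ^ 2) / 2))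
    (f' := fun x => (n + 1) * (x ^ n * Real.exp (-(b * x ^ 2) / 2)) -
      b * (x ^ (n + 2) * Real.exp (-(b * x ^ 2) / 2))) (fun x => ?_)
    (((hi n).const_mul _).sub ((hi (n + 2)).const_mul _)) (hi (n + 1))
  · rw [integral_sub ((hi n).const_mul _) ((hi (n + 2)).const_mul _), integral_const_mul,
      integral_const_mul] at h
    rw [div_mul_eq_mul_div, eq_div_iff hb.ne']
    linarith
  · have h1 : HasDerivAt (fun x : ℝ => -(b * x ^ 2) / 2) (-(b * (2 * x)) / 2) x := by
      simpa using (((hasDerivAt_pow 2 x).const_mul b).neg).div_const 2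
    convert! (hasDerivAt_pow (n + 1) x).mul h1.exp using 1
    push_cast
    ring

lemma integral_exp_neg_mul_sq_div_two (b : ℝ) :
    ∫ x : ℝ, Real.exp (-(b * x ^ 2) / 2) = Real.sqrt (2 * Real.pi / b) := by
  rw [show 2 * Real.pi / b = Real.pi / (b / 2) by ring, ← integral_gaussian]
  congr with x
  ring_nf

lemma integral_id_mul_exp_neg_mul_sq (b : ℝ) :
    ∫ x : ℝ, x * Real.exp (-(b * x ^ 2) / 2) = 0 := by
  have h := integral_neg_eq_self (fun x : ℝ => x * Real.exp (-(b * x ^ 2) / 2)) volume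
  simp only [neg_sq, neg_mul, integral_neg] at h
  linarith

lemma integral_sq_mul_exp_neg_mul_sq {b : ℝ} (hb : 0 < b) :
    ∫ x : ℝ, x ^ 2 * Real.exp (-(b * x ^ 2) / 2) = 1 / b * Real.sqrt (2 * Real.pi / b) := by
  simpa [integral_exp_neg_mul_sq_div_two] using integral_pow_add_two_mul_exp_neg_mul_sq 0 hb

lemma integral_pow_four_mul_exp_neg_mul_sq {b : ℝ} (hb : 0 < b) :
    ∫ x : ℝ, x ^ 4 * Real.exp (-(b * x ^ 2) / 2) = 3 / b ^ 2 * Real.sqrt (2 * Real.pi / b) := by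
  have h := integral_pow_add_two_mul_exp_neg_mul_sq 2 hb
  rw [integral_sq_mul_exp_neg_mul_sq hb] at h
  rw [h]
  field_simp
  norm_num

lemma integral_add_mul_sq_mul_exp_neg_mul_sq (p c : ℝ) {a : ℝ} (ha : 0 < a) :
    ∫ y : ℝ, (p + c * y) ^ 2 * Real.exp (-(a * y ^ 2) / 2) =
      (p ^ 2 + c ^ 2 / a) * Real.sqrt (2 * Real.pi / a) := by
  have h0 := (integrable_pow_mul_exp_neg_mul_sq 0 ha).const_mul (p ^ 2)
  have h1 := (integrable_pow_mul_exp_neg_mul_sq 1 ha).const_mul (2 * p * c)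
  have h2 := (integrable_pow_mul_exp_neg_mul_sq 2 ha).const_mul (c ^ 2)
  have h := integral_add (h0.add h1) h2
  have h' := integral_add h0 h1
  simp only [Pi.add_apply] at h
  rw [h'] at h
  simp only [integral_const_mul, pow_zero, pow_one, one_mul, integral_exp_neg_mul_sq_div_two,
    integral_id_mul_exp_neg_mul_sq, integral_sq_mul_exp_neg_mul_sq ha] at h
  calc _ = _ := by
        congr with y
        ring
    _ = _ := h
    _ = _ := by ring

lemma integral_sq_mul_exp_neg_add_sq (p c t : ℝ) :
    ∫ y : ℝ, (p + c * y) ^ 2 * Real.exp (-(t ^ 2 * (p + c * y) ^ 2) / 2 - y ^ 2 / 2) =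
      (p ^ 2 / (1 + t ^ 2 * c ^ 2) ^ 2 + c ^ 2 / (1 + t ^ 2 * c ^ 2)) *
        Real.sqrt (2 * Real.pi / (1 + t ^ 2 * c ^ 2)) *
          Real.exp (-(t ^ 2 * p ^ 2 / (1 + t ^ 2 * c ^ 2)) / 2) := by
  set a := 1 + t ^ 2 * c ^ 2 with ha_def
  have ha : 0 < a := by positivity
  rw [← integral_sub_right_eq_self _ (t ^ 2 * c * p / a)]
  have key (y : ℝ) : (p + c * (y - t ^ 2 * c * p / a)) ^ 2 *
      Real.exp (-(t ^ 2 * (p + c * (y - t ^ 2 * c * p / a)) ^ 2) / 2 -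
        (y - t ^ 2 * c * p / a) ^ 2 / 2) =
      (p / a + c * y) ^ 2 * Real.exp (-(a * y ^ 2) / 2) *
        Real.exp (-(t ^ 2 * p ^ 2 / a) / 2) := by
    rw [mul_assoc ((p / a + c * y) ^ 2), ← Real.exp_add]
    congr 2
    · field_simp
      rw [ha_def]
      ring
    · field_simp
      rw [ha_def]
      ring
  simp only [key]
  rw [integral_mul_const, integral_add_mul_sq_mul_exp_neg_mul_sq _ _ ha, div_pow]

/-! ### The bivariate Gaussian integrals -/

lemma gpdf_mul_gpdf_mul_gpdf_mul_gpdf (u v x y : ℝ) :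
    gpdf u * gpdf v * (gpdf x * gpdf y) = (2 * Real.pi)⁻¹ ^ 2 *
      (Real.exp (-(u ^ 2) / 2 - x ^ 2 / 2) * Real.exp (-(v ^ 2) / 2 - y ^ 2 / 2)) := by
  have h : (Real.sqrt (2 * Real.pi))⁻¹ ^ 2 = (2 * Real.pi)⁻¹ := by
    rw [inv_pow, Real.sq_sqrt (by positivity)]
  have h1 : Real.exp (-(u ^ 2) / 2 - x ^ 2 / 2) =
      Real.exp (-(u ^ 2) / 2) * Real.exp (-(x ^ 2) / 2) := by
    rw [← Real.exp_add]
    ring_nf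
  have h2 : Real.exp (-(v ^ 2) / 2 - y ^ 2 / 2) =
      Real.exp (-(v ^ 2) / 2) * Real.exp (-(y ^ 2) / 2) := by
    rw [← Real.exp_add]
    ring_nf
  rw [← h, h1, h2]
  unfold gpdf
  ring

lemma integral_sq_mul_sq_mul_gpdf (s t ρ c D : ℝ)
    (hD : D = (1 + s ^ 2) * (1 + t ^ 2 * c ^ 2) + t ^ 2 * ρ ^ 2) :
    ∫ x : ℝ, ∫ y : ℝ, x ^ 2 * (ρ * x + c * y) ^ 2 *
        (gpdf (s * x) * gpdf (t * (ρ * x + c * y)) * (gpdf x * gpdf y)) =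
      (2 * Real.pi)⁻¹ * ((c ^ 2 * D + 3 * ρ ^ 2) / D ^ 2 * (Real.sqrt D)⁻¹) := by
  set a := 1 + t ^ 2 * c ^ 2 with ha_def
  have ha : 0 < a := by positivity
  have hDpos : 0 < D := by rw [hD]; positivity
  have hb : 0 < D / a := by positivity
  have inner (x : ℝ) : ∫ y : ℝ, x ^ 2 * (ρ * x + c * y) ^ 2 *
        (gpdf (s * x) * gpdf (t * (ρ * x + c * y)) * (gpdf x * gpdf y)) =
      (2 * Real.pi)⁻¹ ^ 2 * Real.sqrt (2 * Real.pi / a) *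
        (ρ ^ 2 / a ^ 2 * (x ^ 4 * Real.exp (-(D / a * x ^ 2) / 2)) +
          c ^ 2 / a * (x ^ 2 * Real.exp (-(D / a * x ^ 2) / 2))) := by
    have e : Real.exp (-(D / a * x ^ 2) / 2) = Real.exp (-((s * x) ^ 2) / 2 - x ^ 2 / 2) *
        Real.exp (-(t ^ 2 * (ρ * x) ^ 2 / a) / 2) := by
      rw [← Real.exp_add, hD]
      congr 1
      field_simp
      ring
    have h := integral_sq_mul_exp_neg_add_sq (ρ * x) c t
    rw [← ha_def] at h
    calc _ = ∫ y : ℝ, (2 * Real.pi)⁻¹ ^ 2 * x ^ 2 * Real.exp (-((s * x) ^ 2) / 2 - x ^ 2 / 2) *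
          ((ρ * x + c * y) ^ 2 * Real.exp (-(t ^ 2 * (ρ * x + c * y) ^ 2) / 2 - y ^ 2 / 2)) := by
          congr with y
          rw [gpdf_mul_gpdf_mul_gpdf_mul_gpdf, mul_pow t]
          ring
      _ = _ := by
          rw [integral_const_mul, h, e]
          ring
  simp only [inner]
  rw [integral_const_mul, integral_add ((integrable_pow_mul_exp_neg_mul_sq 4 hb).const_mul _)
    ((integrable_pow_mul_exp_neg_mul_sq 2 hb).const_mul _), integral_const_mul,
    integral_const_mul, integral_pow_four_mul_exp_neg_mul_sq hb, integral_sq_mul_exp_neg_mul_sq hb]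
  have hs : Real.sqrt (2 * Real.pi / a) * Real.sqrt (2 * Real.pi / (D / a)) =
      2 * Real.pi * (Real.sqrt D)⁻¹ := by
    rw [← Real.sqrt_mul (by positivity),
      show 2 * Real.pi / a * (2 * Real.pi / (D / a)) = (2 * Real.pi) ^ 2 / D by field_simp,
      Real.sqrt_div (by positivity), Real.sqrt_sq (by positivity), div_eq_mul_inv]
  calc _ = (2 * Real.pi)⁻¹ ^ 2 * (ρ ^ 2 / a ^ 2 * (3 / (D / a) ^ 2) + c ^ 2 / a * (1 / (D / a))) *
        (Real.sqrt (2 * Real.pi / a) * Real.sqrt (2 * Real.pi / (D / a))) := by ring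
    _ = _ := by
      rw [hs]
      field_simp
      ring

lemma integrable_pow_mul_pow_mul_gpdf (m n : ℕ) :
    Integrable fun q : ℝ × ℝ => q.1 ^ m * q.2 ^ n * (gpdf q.1 * gpdf q.2) := by
  have h (k : ℕ) : Integrable fun x : ℝ => x ^ k * gpdf x := by
    have := (integrable_pow_mul_exp_neg_mul_sq k one_pos).const_mul (Real.sqrt (2 * Real.pi))⁻¹
    convert! this using 2 with x
    simp only [gpdf, one_mul]
    ring
  convert! (h m).mul_prod (h n) using 2 with q
  ring

/-- The density-weighted monomials in the correlated pair `(Z₁, Z₂)` are integrable. -/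
lemma integrable_pow_mul_linear_pow_mul_gpdf (ρ c : ℝ) (m n : ℕ) :
    Integrable fun q : ℝ × ℝ => q.1 ^ m * (ρ * q.1 + c * q.2) ^ n * (gpdf q.1 * gpdf q.2) := by
  have h : Integrable fun q : ℝ × ℝ => ∑ k ∈ Finset.range (n + 1),
      ρ ^ k * c ^ (n - k) * n.choose k * (q.1 ^ (m + k) * q.2 ^ (n - k) * (gpdf q.1 * gpdf q.2)) :=
    integrable_finsetSum _ fun k _ => (integrable_pow_mul_pow_mul_gpdf _ _).const_mul _
  convert! h using 2 with q
  rw [add_pow, Finset.mul_sum, Finset.sum_mul]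
  refine Finset.sum_congr rfl fun k _ => ?_
  rw [mul_pow, mul_pow, pow_add]
  ring

lemma integral_eq_zero_of_odd {f : ℝ × ℝ → ℝ} (hf : ∀ q, f (-q) = -f q) : ∫ q, f q = 0 := by
  have h := integral_neg_eq_self f volume
  simp only [hf, integral_neg] at h
  linarith

/-! ### Derivatives of the closed form -/

lemma hasDerivAt_inv_sqrt_add_mul_sq {p m : ℝ} (hp : 0 < p) (hm : 0 ≤ m) (s : ℝ) :
    HasDerivAt (fun s => (Real.sqrt (p + m * s ^ 2))⁻¹)
      (-(m * s) / (p + m * s ^ 2) * (Real.sqrt (p + m * s ^ 2))⁻¹) s := by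
  have hD : 0 < p + m * s ^ 2 := by positivity
  have h1 : HasDerivAt (fun s : ℝ => p + m * s ^ 2) (m * (2 * s)) s := by
    simpa using ((hasDerivAt_pow 2 s).const_mul m).const_add p
  have hs : Real.sqrt (p + m * s ^ 2) ≠ 0 := (Real.sqrt_pos.2 hD).ne'
  convert! (h1.sqrt hD.ne').inv hs using 1
  rw [Real.sq_sqrt hD.le]
  field_simp

/-- The discriminant `1 + s² + t² + s²t²(1-ρ²)` of the closed form. -/
noncomputable def kernelDisc (ρ s t : ℝ) : ℝ := 1 + s ^ 2 + t ^ 2 + s ^ 2 * t ^ 2 * (1 - ρ ^ 2)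

/-- `2π E[Z₁² Z₂ φ(s Z₁) Φ(t Z₂)]` in closed form. -/
noncomputable def kernelDerivForm (ρ s t : ℝ) : ℝ :=
  t / (1 + s ^ 2) ^ 2 * ((2 * ρ ^ 2 * kernelDisc ρ s t +
    (1 + (1 - ρ ^ 2) * s ^ 2) * (kernelDisc ρ s t - ρ ^ 2 * t ^ 2)) / kernelDisc ρ s t *
      (Real.sqrt (kernelDisc ρ s t))⁻¹)

/-- `2π E[Z₁ Z₂ (Φ(s Z₁) Φ(t Z₂) - 1/4)]` in closed form. -/
noncomputable def kernelForm (ρ s t : ℝ) : ℝ :=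
  s * t * (ρ ^ 2 + kernelDisc ρ s t) / ((1 + s ^ 2) * (1 + t ^ 2)) *
    (Real.sqrt (kernelDisc ρ s t))⁻¹ +
  ρ * Real.arctan (ρ * s * t * (Real.sqrt (kernelDisc ρ s t))⁻¹)

lemma kernelDisc_comm (ρ s t : ℝ) : kernelDisc ρ s t = kernelDisc ρ t s := by
  unfold kernelDisc
  ring

lemma kernelDisc_pos {ρ : ℝ} (hρ : 0 ≤ 1 - ρ ^ 2) (s t : ℝ) : 0 < kernelDisc ρ s t := by
  unfold kernelDisc
  positivity

lemma hasDerivAt_kernelDisc (ρ s t : ℝ) :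
    HasDerivAt (fun t => kernelDisc ρ s t) ((1 + (1 - ρ ^ 2) * s ^ 2) * (2 * t)) t := by
  have h := ((hasDerivAt_pow 2 t).const_mul (1 + (1 - ρ ^ 2) * s ^ 2)).const_add (1 + s ^ 2)
  convert! h using 1
  · ext t
    unfold kernelDisc
    ring
  · norm_num

lemma hasDerivAt_inv_sqrt_kernelDisc {ρ : ℝ} (hρ : 0 ≤ 1 - ρ ^ 2) (s t : ℝ) :
    HasDerivAt (fun t => (Real.sqrt (kernelDisc ρ s t))⁻¹)
      (-((1 + (1 - ρ ^ 2) * s ^ 2) * t) / kernelDisc ρ s t * (Real.sqrt (kernelDisc ρ s t))⁻¹)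
      t := by
  have e (t : ℝ) : kernelDisc ρ s t = (1 + s ^ 2) + (1 + (1 - ρ ^ 2) * s ^ 2) * t ^ 2 := by
    unfold kernelDisc
    ring
  simp only [e]
  exact hasDerivAt_inv_sqrt_add_mul_sq (by positivity) (by positivity) t

lemma hasDerivAt_kernelDerivForm {ρ : ℝ} (hρ : 0 ≤ 1 - ρ ^ 2) (s t : ℝ) :
    HasDerivAt (fun t => kernelDerivForm ρ s t)
      (((1 - ρ ^ 2) * kernelDisc ρ s t + 3 * ρ ^ 2) / kernelDisc ρ s t ^ 2 *
        (Real.sqrt (kernelDisc ρ s t))⁻¹) t := by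
  have hD := hasDerivAt_kernelDisc ρ s t
  have hw := hasDerivAt_inv_sqrt_kernelDisc hρ s t
  have h0 := (kernelDisc_pos hρ s t).ne'
  have hN := (hD.const_mul (2 * ρ ^ 2)).add
    ((hD.sub ((hasDerivAt_pow 2 t).const_mul (ρ ^ 2))).const_mul (1 + (1 - ρ ^ 2) * s ^ 2))
  have h := ((hasDerivAt_id t).div_const ((1 + s ^ 2) ^ 2)).mul ((hN.div hD h0).mul hw)
  convert! h using 1
  simp only [Pi.add_apply, Pi.mul_apply, Pi.div_apply, Pi.sub_apply, id_eq]
  have hE : kernelDisc ρ s t = 1 + s ^ 2 + t ^ 2 + s ^ 2 * t ^ 2 * (1 - ρ ^ 2) := rfl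
  generalize (Real.sqrt (kernelDisc ρ s t))⁻¹ = w
  generalize kernelDisc ρ s t = D at h0 hE ⊢
  have hA : 1 + s ^ 2 ≠ 0 := by positivity
  field_simp
  rw [hE]
  push_cast
  ring

lemma kernelForm_comm (ρ s t : ℝ) : kernelForm ρ s t = kernelForm ρ t s := by
  unfold kernelForm
  rw [kernelDisc_comm, mul_comm s t, mul_comm (1 + s ^ 2), mul_right_comm ρ s t]

lemma hasDerivAt_kernelForm_right {ρ : ℝ} (hρ : 0 ≤ 1 - ρ ^ 2) (s t : ℝ) :
    HasDerivAt (fun t => kernelForm ρ s t) (kernelDerivForm ρ t s) t := by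
  have hD := hasDerivAt_kernelDisc ρ s t
  have hw := hasDerivAt_inv_sqrt_kernelDisc hρ s t
  have h0 := kernelDisc_pos hρ s t
  have hA : 1 + s ^ 2 ≠ 0 := by positivity
  have hB : 1 + t ^ 2 ≠ 0 := by positivity
  have hAB : (1 + s ^ 2) * (1 + t ^ 2) ≠ 0 := mul_ne_zero hA hB
  have hB' : HasDerivAt (fun t : ℝ => (1 + s ^ 2) * (1 + t ^ 2)) ((1 + s ^ 2) * (2 * t)) t := by
    simpa using ((hasDerivAt_pow 2 t).const_add 1).const_mul (1 + s ^ 2)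
  have h1 := ((((hasDerivAt_id t).const_mul s).mul (hD.const_add (ρ ^ 2))).div hB' hAB).mul hw
  have h2 := ((((hasDerivAt_id t).const_mul (ρ * s)).mul hw).arctan).const_mul ρ
  convert! h1.add h2 using 1
  simp only [Pi.mul_apply, Pi.div_apply, id_eq]
  have hE : kernelDisc ρ s t = 1 + s ^ 2 + t ^ 2 + s ^ 2 * t ^ 2 * (1 - ρ ^ 2) := rfl
  have hw2 : 1 + (ρ * s * t * (Real.sqrt (kernelDisc ρ s t))⁻¹) ^ 2 =
      (1 + s ^ 2) * (1 + t ^ 2) / kernelDisc ρ s t := by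
    rw [mul_pow, inv_pow, Real.sq_sqrt h0.le]
    field_simp
    rw [hE]
    ring
  rw [hw2, kernelDerivForm, kernelDisc_comm ρ t s]
  replace h0 := h0.ne'
  generalize (Real.sqrt (kernelDisc ρ s t))⁻¹ = w
  generalize kernelDisc ρ s t = D at h0 hE ⊢
  field_simp
  rw [hE]
  ring

lemma hasDerivAt_kernelForm_left {ρ : ℝ} (hρ : 0 ≤ 1 - ρ ^ 2) (s t : ℝ) :
    HasDerivAt (fun s => kernelForm ρ s t) (kernelDerivForm ρ s t) s := by
  simpa only [kernelForm_comm ρ _ t] using hasDerivAt_kernelForm_right hρ t s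

/-- A function on `ℝ` is determined by its derivative and its value at `0`. -/
lemma eq_of_hasDerivAt_eq_of_eq_zero {f g f' : ℝ → ℝ} (hf : ∀ x, HasDerivAt f (f' x) x)
    (hg : ∀ x, HasDerivAt g (f' x) x) (h0 : f 0 = g 0) (x : ℝ) : f x = g x := by
  have h (y : ℝ) : HasDerivAt (f - g) 0 y := by
    simpa using (hf y).sub (hg y)
  have := is_const_of_deriv_eq_zero (fun y => (h y).differentiableAt) (fun y => (h y).deriv) x 0
  simp only [Pi.sub_apply] at this
  linarith

/-! ### The kernel as an integral over the plane -/

section Plane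

variable {ρ c : ℝ}

lemma integral_sq_mul_gpdf_mul_gcdf (hρ : 0 ≤ 1 - ρ ^ 2) (hc : c ^ 2 = 1 - ρ ^ 2) (s t : ℝ) :
    ∫ q : ℝ × ℝ, q.1 ^ 2 * (ρ * q.1 + c * q.2) * (gpdf q.1 * gpdf q.2) * gpdf (s * q.1) *
      gcdf (t * (ρ * q.1 + c * q.2)) = (2 * Real.pi)⁻¹ * kernelDerivForm ρ s t := by
  have hm : AEStronglyMeasurable (fun q : ℝ × ℝ => gpdf (s * q.1)) :=
    (continuous_gpdf.comp (by fun_prop)).aestronglyMeasurable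
  have hg : Integrable fun q : ℝ × ℝ =>
      q.1 ^ 2 * (ρ * q.1 + c * q.2) * (gpdf q.1 * gpdf q.2) * gpdf (s * q.1) := by
    have := (integrable_pow_mul_linear_pow_mul_gpdf ρ c 2 1).mul_bdd hm
      (.of_forall fun q => norm_gpdf_le_one _)
    simpa only [pow_one] using this
  have hgz : Integrable fun q : ℝ × ℝ =>
      q.1 ^ 2 * (ρ * q.1 + c * q.2) * (gpdf q.1 * gpdf q.2) * gpdf (s * q.1) *
        (ρ * q.1 + c * q.2) := by
    convert! (integrable_pow_mul_linear_pow_mul_gpdf ρ c 2 2).mul_bdd hm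
      (.of_forall fun q => norm_gpdf_le_one _) using 2 with q
    ring
  have hz : Continuous fun q : ℝ × ℝ => ρ * q.1 + c * q.2 := by fun_prop
  refine eq_of_hasDerivAt_eq_of_eq_zero (g := fun t => (2 * Real.pi)⁻¹ * kernelDerivForm ρ s t)
    (hasDerivAt_integral_mul_gcdf hg hz.aestronglyMeasurable hgz) (fun t => ?_) ?_ t
  · convert! (hasDerivAt_kernelDerivForm hρ s t).const_mul (2 * Real.pi)⁻¹ using 1
    rw [← hc, ← integral_sq_mul_sq_mul_gpdf s t ρ c (kernelDisc ρ s t)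
      (by rw [hc]; unfold kernelDisc; ring), Measure.volume_eq_prod, integral_prod]
    · congr with x
      congr with y
      ring
    · exact hgz.mul_bdd (continuous_gpdf.comp (by fun_prop)).aestronglyMeasurable
        (.of_forall fun q => norm_gpdf_le_one _)
  · rw [integral_eq_zero_of_odd]
    · simp [kernelDerivForm]
    · intro q
      simp only [Prod.fst_neg, Prod.snd_neg, mul_neg, gpdf_neg, zero_mul]
      ring_nf

lemma integral_mul_gcdf (ρ c t : ℝ) :
    ∫ q : ℝ × ℝ, q.1 * (ρ * q.1 + c * q.2) * (gpdf q.1 * gpdf q.2) *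
      gcdf (t * (ρ * q.1 + c * q.2)) = ρ / 2 := by
  have hg : Integrable fun q : ℝ × ℝ => q.1 * (ρ * q.1 + c * q.2) * (gpdf q.1 * gpdf q.2) := by
    simpa only [pow_one] using integrable_pow_mul_linear_pow_mul_gpdf ρ c 1 1
  have hgz : Integrable fun q : ℝ × ℝ =>
      q.1 * (ρ * q.1 + c * q.2) * (gpdf q.1 * gpdf q.2) * (ρ * q.1 + c * q.2) := by
    convert! integrable_pow_mul_linear_pow_mul_gpdf ρ c 1 2 using 2 with q
    ring
  have hz : Continuous fun q : ℝ × ℝ => ρ * q.1 + c * q.2 := by fun_prop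
  refine eq_of_hasDerivAt_eq_of_eq_zero (g := fun _ => ρ / 2)
    (hasDerivAt_integral_mul_gcdf hg hz.aestronglyMeasurable hgz) (fun t => ?_) ?_ t
  · rw [integral_eq_zero_of_odd]
    · exact hasDerivAt_const _ _
    · intro q
      have e : t * (ρ * -q.1 + c * -q.2) = -(t * (ρ * q.1 + c * q.2)) := by ring
      simp only [Prod.fst_neg, Prod.snd_neg, e, gpdf_neg]
      ring
  · have h2 : ∫ x, x ^ 2 * gpdf x = 1 := by
      have h := integral_sq_mul_exp_neg_mul_sq one_pos
      calc _ = ∫ x : ℝ, (Real.sqrt (2 * Real.pi))⁻¹ * (x ^ 2 * Real.exp (-(1 * x ^ 2) / 2)) := by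
            congr with x
            simp only [gpdf, one_mul]
            ring
        _ = 1 := by
            rw [integral_const_mul, h, div_one, div_one, one_mul]
            exact inv_mul_cancel₀ (by positivity)
    have h1 : ∫ x, x * gpdf x = 0 := by
      have h := integral_neg_eq_self (fun x => x * gpdf x) volume
      simp only [gpdf_neg, neg_mul, integral_neg] at h
      linarith
    simp only [zero_mul, gcdf_zero]
    rw [integral_mul_const]
    have i1 := (integrable_pow_mul_pow_mul_gpdf 2 0).const_mul ρ
    have i2 := (integrable_pow_mul_pow_mul_gpdf 1 1).const_mul c
    have e : (fun q : ℝ × ℝ => q.1 * (ρ * q.1 + c * q.2) * (gpdf q.1 * gpdf q.2)) = fun q =>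
        ρ * (q.1 ^ 2 * q.2 ^ 0 * (gpdf q.1 * gpdf q.2)) +
          c * (q.1 ^ 1 * q.2 ^ 1 * (gpdf q.1 * gpdf q.2)) := by
      ext q
      ring
    have p (m n : ℕ) : ∫ q : ℝ × ℝ, q.1 ^ m * q.2 ^ n * (gpdf q.1 * gpdf q.2) =
        (∫ x, x ^ m * gpdf x) * ∫ y, y ^ n * gpdf y := by
      rw [← integral_prod_mul, ← Measure.volume_eq_prod]
      congr with q
      ring
    rw [e, integral_add i1 i2, integral_const_mul, integral_const_mul, p, p]
    simp only [pow_zero, pow_one, one_mul, h1, h2, integral_gpdf]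
    ring

lemma integral_mul_gcdf_mul_gcdf (hρ : 0 ≤ 1 - ρ ^ 2) (hc : c ^ 2 = 1 - ρ ^ 2) (s t : ℝ) :
    ∫ x : ℝ, ∫ y : ℝ, (x * (ρ * x + c * y) * gcdf (s * x) * gcdf (t * (ρ * x + c * y))) *
      gpdf x * gpdf y = ρ / 4 + (2 * Real.pi)⁻¹ * kernelForm ρ s t := by
  have hm : AEStronglyMeasurable (fun q : ℝ × ℝ => gcdf (t * (ρ * q.1 + c * q.2))) :=
    (continuous_gcdf.comp (by fun_prop)).aestronglyMeasurable
  have hg : Integrable fun q : ℝ × ℝ => q.1 * (ρ * q.1 + c * q.2) * (gpdf q.1 * gpdf q.2) *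
      gcdf (t * (ρ * q.1 + c * q.2)) := by
    have := (integrable_pow_mul_linear_pow_mul_gpdf ρ c 1 1).mul_bdd hm
      (.of_forall fun q => norm_gcdf_le_one _)
    simpa only [pow_one] using this
  have hgz : Integrable fun q : ℝ × ℝ => q.1 * (ρ * q.1 + c * q.2) * (gpdf q.1 * gpdf q.2) *
      gcdf (t * (ρ * q.1 + c * q.2)) * q.1 := by
    convert! (integrable_pow_mul_linear_pow_mul_gpdf ρ c 2 1).mul_bdd hm
      (.of_forall fun q => norm_gcdf_le_one _) using 2 with q
    ring
  have key : ∫ q : ℝ × ℝ, q.1 * (ρ * q.1 + c * q.2) * (gpdf q.1 * gpdf q.2) *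
      gcdf (t * (ρ * q.1 + c * q.2)) * gcdf (s * q.1) =
        ρ / 4 + (2 * Real.pi)⁻¹ * kernelForm ρ s t := by
    refine eq_of_hasDerivAt_eq_of_eq_zero
      (g := fun s => ρ / 4 + (2 * Real.pi)⁻¹ * kernelForm ρ s t)
      (hasDerivAt_integral_mul_gcdf hg continuous_fst.aestronglyMeasurable hgz) (fun s => ?_) ?_ s
    · convert! ((hasDerivAt_kernelForm_left hρ s t).const_mul (2 * Real.pi)⁻¹).const_add
        (ρ / 4) using 1
      rw [← integral_sq_mul_gpdf_mul_gcdf hρ hc s t]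
      congr with q
      ring
    · simp only [zero_mul, gcdf_zero]
      rw [integral_mul_const, integral_mul_gcdf]
      simp [kernelForm]
      ring
  rw [← key, Measure.volume_eq_prod, integral_prod]
  · congr with x
    congr with y
    ring
  · exact hg.mul_bdd (continuous_gcdf.comp (by fun_prop)).aestronglyMeasurable
      (.of_forall fun q => norm_gcdf_le_one _)

end Plane

/-- Closed-form covariance function of an infinitely wide one-hidden-layer network
with GELU activation `ψ(z) = z·Φ(z)`.  The bivariate Gaussian pair `(Z₁, Z₂)` with unit
variances and correlation `ρ` is realised as `Z₁ = x`, `Z₂ = ρ·x + √(1−ρ²)·y` for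
independent standard Gaussians `x, y`. -/
theorem gelu_kernel (σw σb s1 s2 ρ : ℝ) (hσw : 0 ≤ σw) (hσb : 0 ≤ σb)
    (hs1 : 0 < s1) (hs2 : 0 < s2) (hρ : ρ ∈ Set.Icc (-1 : ℝ) 1) :
    σb ^ 2 + σw ^ 2 * (s1 * s2 *
      ∫ x : ℝ, ∫ y : ℝ,
        (x * (ρ * x + Real.sqrt (1 - ρ ^ 2) * y) *
          gcdf (s1 * x) * gcdf (s2 * (ρ * x + Real.sqrt (1 - ρ ^ 2) * y))) *
          gpdf x * gpdf y)
    = σb ^ 2 + σw ^ 2 * (s1 * s2 / 4 * ρ + s1 ^ 2 * s2 ^ 2 / (2 * Real.pi) *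
        ((ρ ^ 2 + 1 + s1 ^ 2 + s2 ^ 2 + s1 ^ 2 * s2 ^ 2 * (1 - ρ ^ 2)) /
          ((1 + s1 ^ 2) * (1 + s2 ^ 2) *
            Real.sqrt (1 + s1 ^ 2 + s2 ^ 2 + s1 ^ 2 * s2 ^ 2 * (1 - ρ ^ 2)))
        + ρ / (s1 * s2) *
          Real.arctan (ρ * s1 * s2 /
            Real.sqrt (1 + s1 ^ 2 + s2 ^ 2 + s1 ^ 2 * s2 ^ 2 * (1 - ρ ^ 2))))) := by
  have hρ' : 0 ≤ 1 - ρ ^ 2 := by nlinarith [hρ.1, hρ.2]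
  rw [integral_mul_gcdf_mul_gcdf hρ' (Real.sq_sqrt hρ') s1 s2, kernelForm]
  have hE : kernelDisc ρ s1 s2 = 1 + s1 ^ 2 + s2 ^ 2 + s1 ^ 2 * s2 ^ 2 * (1 - ρ ^ 2) := rfl
  have hpos := Real.sqrt_pos.2 (kernelDisc_pos hρ' s1 s2)
  rw [show ρ ^ 2 + 1 + s1 ^ 2 + s2 ^ 2 + s1 ^ 2 * s2 ^ 2 * (1 - ρ ^ 2) =
    ρ ^ 2 + kernelDisc ρ s1 s2 by rw [hE]; ring, ← hE, ← div_eq_mul_inv (ρ * s1 * s2)]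
  field_simp
end

section
/- Let Z be a standard real Gaussian random variable and s ∈ ℝ. Then E[Z²·Φ(s·Z)²] = 1/4 + (1/(2π))·arcsin(s²/(1+s²)) + s²/(π·(1+s²)·√(1+2s²)). -/
open Real MeasureTheory

lemma integrable_pow_mul_exp_neg_mul_sq_half (n : ℕ) {b : ℝ} (hb : 0 < b) :
    Integrable fun z : ℝ => z ^ n * rexp (-b * z ^ 2 / 2) := by
  have h := integrable_rpow_mul_exp_neg_mul_sq (half_pos hb) (s := n)
    (by have := n.cast_nonneg (α := ℝ); linarith)
  refine h.congr (Filter.Eventually.of_forall fun z => ?_)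
  simp only [Real.rpow_natCast]
  congr 2; ring

lemma hasDerivAt_exp_neg_mul_sq_half (b z : ℝ) :
    HasDerivAt (fun z : ℝ => rexp (-b * z ^ 2 / 2)) (-b * z * rexp (-b * z ^ 2 / 2)) z := by
  convert (((hasDerivAt_pow 2 z).const_mul (-b)).div_const 2).exp using 1
  push_cast
  ring

lemma integral_exp_neg_mul_sq_half (b : ℝ) :
    ∫ z : ℝ, rexp (-b * z ^ 2 / 2) = √(2 * π) / √b := by
  have h := integral_gaussian (b / 2)
  rw [← Real.sqrt_div (by positivity), mul_comm 2 π, ← div_div_eq_mul_div, ← h]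
  congr 1
  ext z
  congr 1
  ring

lemma integral_sq_mul_exp_neg_mul_sq_half {b : ℝ} (hb : 0 < b) :
    ∫ z : ℝ, z ^ 2 * rexp (-b * z ^ 2 / 2) = √(2 * π) / (b * √b) := by
  have h0 := integrable_pow_mul_exp_neg_mul_sq_half 0 hb
  have h1 := integrable_pow_mul_exp_neg_mul_sq_half 1 hb
  have h2 := integrable_pow_mul_exp_neg_mul_sq_half 2 hb
  have h := integral_mul_deriv_eq_deriv_mul_of_integrable
    (u := fun z : ℝ => z) (u' := fun _ => 1) (v := fun z => rexp (-b * z ^ 2 / 2))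
    (v' := fun z => -b * z * rexp (-b * z ^ 2 / 2))
    (fun z _ => hasDerivAt_id z) (fun z _ => hasDerivAt_exp_neg_mul_sq_half b z)
    ((h2.const_mul (-b)).congr (Filter.Eventually.of_forall fun z => by
      simp only [Pi.mul_apply]; ring))
    (h0.congr (Filter.Eventually.of_forall fun z => by simp))
    (h1.congr (Filter.Eventually.of_forall fun z => by simp))
  have e : ∀ z : ℝ, z * (-b * z * rexp (-b * z ^ 2 / 2))
    = -b * (z ^ 2 * rexp (-b * z ^ 2 / 2)) := fun z => by ring
  simp only [e, one_mul, integral_const_mul, integral_exp_neg_mul_sq_half] at h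
  have hs : √b ≠ 0 := (Real.sqrt_pos.2 hb).ne'
  field_simp at h ⊢
  linarith

lemma gpdf_mul_gpdf (s z : ℝ) :
    gpdf (s * z) * gpdf z = (2 * π)⁻¹ * rexp (-(1 + s ^ 2) * z ^ 2 / 2) := by
  unfold gpdf
  rw [mul_mul_mul_comm, ← Real.exp_add, ← mul_inv, Real.mul_self_sqrt (by positivity)]
  congr 2; ring

lemma exp_mul_gpdf (s z : ℝ) :
    rexp (-(1 + s ^ 2) * z ^ 2 / 2) * gpdf (s * z)
      = (√(2 * π))⁻¹ * rexp (-(1 + 2 * s ^ 2) * z ^ 2 / 2) := by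
  unfold gpdf
  rw [mul_left_comm, ← Real.exp_add]
  congr 2; ring

lemma MeasureTheory.Integrable.mul_gcdf {f : ℝ → ℝ} (hf : Integrable f) (s : ℝ) :
    Integrable fun z => gcdf (s * z) * f z := by
  refine hf.bdd_mul (c := 1)
    (continuous_gcdf.comp (continuous_const.mul continuous_id)).aestronglyMeasurable ?_
  refine Filter.Eventually.of_forall fun z => ?_
  rw [Real.norm_eq_abs, abs_of_nonneg (gcdf_nonneg _)]
  exact gcdf_le_one _

lemma hasDerivAt_gcdf_mul_left (s z : ℝ) :
    HasDerivAt (fun s => gcdf (s * z)) (gpdf (s * z) * z) s := by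
  exact ((hasDerivAt_gcdf (s * z)).comp s ((hasDerivAt_id s).mul_const z)).congr_deriv
    (by rw [one_mul])

lemma hasDerivAt_gcdf_mul_right (s z : ℝ) :
    HasDerivAt (fun z => gcdf (s * z)) (gpdf (s * z) * s) z := by
  exact ((hasDerivAt_gcdf (s * z)).comp z ((hasDerivAt_id z).const_mul s)).congr_deriv
    (by rw [mul_one])

lemma integral_gcdf_mul_cube_mul_exp (s : ℝ) :
    ∫ z : ℝ, gcdf (s * z) * (z ^ 3 * rexp (-(1 + s ^ 2) * z ^ 2 / 2))
      = s * (1 / ((1 + s ^ 2) * ((1 + 2 * s ^ 2) * √(1 + 2 * s ^ 2)))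
        + 2 / ((1 + s ^ 2) ^ 2 * √(1 + 2 * s ^ 2))) := by
  have ha : 0 < 1 + s ^ 2 := by positivity
  have hb : 0 < 1 + 2 * s ^ 2 := by positivity
  have ha0 := integrable_pow_mul_exp_neg_mul_sq_half 0 ha
  have ha2 := integrable_pow_mul_exp_neg_mul_sq_half 2 ha
  have ha3 := integrable_pow_mul_exp_neg_mul_sq_half 3 ha
  have hb0 := integrable_pow_mul_exp_neg_mul_sq_half 0 hb
  have hb2 := integrable_pow_mul_exp_neg_mul_sq_half 2 hb
  have ib0 := integral_exp_neg_mul_sq_half (1 + 2 * s ^ 2)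
  have ib2 := integral_sq_mul_exp_neg_mul_sq_half hb
  have key := exp_mul_gpdf s
  have hI := (hb2.const_mul (1 / (1 + s ^ 2))).add (hb0.const_mul (2 / (1 + s ^ 2) ^ 2))
  have e : ∀ z : ℝ, gpdf (s * z) * s *
      (-(z ^ 2 / (1 + s ^ 2) + 2 / (1 + s ^ 2) ^ 2) * rexp (-(1 + s ^ 2) * z ^ 2 / 2))
      = -(s * (√(2 * π))⁻¹) * (1 / (1 + s ^ 2) * (z ^ 2 * rexp (-(1 + 2 * s ^ 2) * z ^ 2 / 2))
        + 2 / (1 + s ^ 2) ^ 2 * (z ^ 0 * rexp (-(1 + 2 * s ^ 2) * z ^ 2 / 2))) := fun z => by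
    linear_combination
      (-(s * (z ^ 2 / (1 + s ^ 2) + 2 / (1 + s ^ 2) ^ 2))) * key z
  have hW : Integrable fun z : ℝ =>
      -(z ^ 2 / (1 + s ^ 2) + 2 / (1 + s ^ 2) ^ 2) * rexp (-(1 + s ^ 2) * z ^ 2 / 2) :=
    ((ha2.const_mul (-(1 / (1 + s ^ 2)))).add (ha0.const_mul (-(2 / (1 + s ^ 2) ^ 2)))).congr
      (Filter.Eventually.of_forall fun z => by simp only [Pi.add_apply]; ring)
  have h := integral_mul_deriv_eq_deriv_mul_of_integrable
    (u := fun z : ℝ => gcdf (s * z)) (u' := fun z => gpdf (s * z) * s)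
    (v := fun z => -(z ^ 2 / (1 + s ^ 2) + 2 / (1 + s ^ 2) ^ 2) * rexp (-(1 + s ^ 2) * z ^ 2 / 2))
    (v' := fun z => z ^ 3 * rexp (-(1 + s ^ 2) * z ^ 2 / 2))
    (fun z _ => hasDerivAt_gcdf_mul_right s z)
    (fun z _ => by
      refine HasDerivAt.congr_deriv (((((hasDerivAt_pow 2 z).div_const (1 + s ^ 2)).add_const
        (2 / (1 + s ^ 2) ^ 2)).neg).mul (hasDerivAt_exp_neg_mul_sq_half (1 + s ^ 2) z)) ?_
      simp only [Pi.neg_apply]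
      push_cast
      field_simp
      ring)
    (ha3.mul_gcdf s)
    ((hI.const_mul (-(s * (√(2 * π))⁻¹))).congr (Filter.Eventually.of_forall fun z => (e z).symm))
    (hW.mul_gcdf s)
  rw [h]
  simp only [e]
  rw [integral_const_mul, integral_add (hb2.const_mul _) (hb0.const_mul _), integral_const_mul,
    integral_const_mul, ib2]
  simp only [pow_zero, one_mul]
  rw [ib0]
  have hs : √(1 + 2 * s ^ 2) ≠ 0 := (Real.sqrt_pos.2 hb).ne'
  have hp : √(2 * π) ≠ 0 := (Real.sqrt_pos.2 (by positivity)).ne'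
  field_simp

lemma integrable_pow_mul_gpdf (n : ℕ) : Integrable fun z : ℝ => z ^ n * gpdf z := by
  refine ((integrable_pow_mul_exp_neg_mul_sq_half n one_pos).const_mul (√(2 * π))⁻¹).congr
    (Filter.Eventually.of_forall fun z => ?_)
  simp only [gpdf, neg_mul, one_mul]
  ring

lemma integral_sq_mul_gpdf : ∫ z : ℝ, z ^ 2 * gpdf z = 1 := by
  have h := integral_sq_mul_exp_neg_mul_sq_half one_pos
  simp only [neg_mul, one_mul, Real.sqrt_one, div_one] at h
  simp only [gpdf, mul_left_comm _ (√(2 * π))⁻¹]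
  rw [integral_const_mul, h]
  exact inv_mul_cancel₀ (Real.sqrt_pos.2 (by positivity)).ne'

lemma hasDerivAt_integral_sq_mul_gcdf_sq (s : ℝ) :
    HasDerivAt (fun s => ∫ z : ℝ, z ^ 2 * (gcdf (s * z)) ^ 2 * gpdf z)
      (π⁻¹ * (s * (1 / ((1 + s ^ 2) * ((1 + 2 * s ^ 2) * √(1 + 2 * s ^ 2)))
        + 2 / ((1 + s ^ 2) ^ 2 * √(1 + 2 * s ^ 2))))) s := by
  have hc (t : ℝ) : Continuous fun z => gcdf (t * z) :=
    continuous_gcdf.comp (continuous_const.mul continuous_id)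
  have hd (t : ℝ) : Continuous fun z => gpdf (t * z) :=
    continuous_gpdf.comp (continuous_const.mul continuous_id)
  have hm (t : ℝ) : Continuous fun z => z ^ 2 * (gcdf (t * z)) ^ 2 * gpdf z :=
    ((continuous_pow 2).mul ((hc t).pow 2)).mul continuous_gpdf
  have h := hasDerivAt_integral_of_dominated_loc_of_deriv_le (μ := volume) (x₀ := s)
    (F := fun t z => z ^ 2 * (gcdf (t * z)) ^ 2 * gpdf z)
    (F' := fun t z => z ^ 2 * (2 * gcdf (t * z) * (gpdf (t * z) * z)) * gpdf z)
    (bound := fun z => ‖2 * (z ^ 3 * gpdf z)‖) (s := Set.univ) Filter.univ_mem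
    (Filter.Eventually.of_forall fun t => (hm t).aestronglyMeasurable)
    ((((integrable_pow_mul_gpdf 2).mul_gcdf s).mul_gcdf s).congr
      (Filter.Eventually.of_forall fun z => by ring))
    (((continuous_pow 2).mul ((continuous_const.mul (hc s)).mul ((hd s).mul continuous_id))).mul
      continuous_gpdf).aestronglyMeasurable
    (Filter.Eventually.of_forall fun z t _ => by
      have e : z ^ 2 * (2 * gcdf (t * z) * (gpdf (t * z) * z)) * gpdf z
        = (gcdf (t * z) * gpdf (t * z)) * (2 * (z ^ 3 * gpdf z)) := by ring
      rw [e, norm_mul]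
      refine mul_le_of_le_one_left (norm_nonneg _) ?_
      rw [Real.norm_eq_abs, abs_of_nonneg (mul_nonneg (gcdf_nonneg _) (gpdf_nonneg _))]
      exact mul_le_one₀ (gcdf_le_one _) (gpdf_nonneg _) (gpdf_le_one _))
    ((integrable_pow_mul_gpdf 3).const_mul 2).norm
    (Filter.Eventually.of_forall fun z t _ => by
      refine ((((hasDerivAt_gcdf_mul_left t z).pow 2).const_mul (z ^ 2)).mul_const
        (gpdf z)).congr_deriv ?_
      norm_num)
  refine h.2.congr_deriv ?_
  rw [← integral_gcdf_mul_cube_mul_exp, ← integral_const_mul]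
  congr 1
  ext z
  have key := gpdf_mul_gpdf s z
  rw [mul_inv] at key
  linear_combination (2 * z ^ 3 * gcdf (s * z)) * key

lemma hasDerivAt_arcsin_formula (s : ℝ) :
    HasDerivAt (fun s : ℝ => 1 / 4 + (1 / (2 * π)) * arcsin (s ^ 2 / (1 + s ^ 2))
      + s ^ 2 / (π * (1 + s ^ 2) * √(1 + 2 * s ^ 2)))
      (π⁻¹ * (s * (1 / ((1 + s ^ 2) * ((1 + 2 * s ^ 2) * √(1 + 2 * s ^ 2)))
        + 2 / ((1 + s ^ 2) ^ 2 * √(1 + 2 * s ^ 2))))) s := by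
  have ha : 0 < 1 + s ^ 2 := by positivity
  have hb : 0 < 1 + 2 * s ^ 2 := by positivity
  have hr : 0 < √(1 + 2 * s ^ 2) := Real.sqrt_pos.2 hb
  have hsq : √(1 + 2 * s ^ 2) ^ 2 = 1 + 2 * s ^ 2 := Real.sq_sqrt hb.le
  have hq : HasDerivAt (fun s : ℝ => s ^ 2) (2 * s) s := by simpa using hasDerivAt_pow 2 s
  have hA : HasDerivAt (fun s : ℝ => 1 + s ^ 2) (2 * s) s := hq.const_add 1
  have hB : HasDerivAt (fun s : ℝ => 1 + 2 * s ^ 2) (2 * (2 * s)) s := (hq.const_mul 2).const_add 1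
  have hlt : s ^ 2 / (1 + s ^ 2) < 1 := by rw [div_lt_one ha]; linarith
  have hgt : -1 < s ^ 2 / (1 + s ^ 2) := lt_of_lt_of_le neg_one_lt_zero (by positivity)
  have hroot : √(1 - (s ^ 2 / (1 + s ^ 2)) ^ 2) = √(1 + 2 * s ^ 2) / (1 + s ^ 2) := by
    rw [Real.sqrt_eq_iff_mul_self_eq_of_pos (by positivity)]
    field_simp
    rw [hsq]
    ring
  have h1 := (Real.hasDerivAt_arcsin hgt.ne' hlt.ne).comp s (hq.div hA ha.ne')
  have h2 := hq.div ((hA.const_mul π).mul (hB.sqrt hb.ne'))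
    (mul_pos (mul_pos pi_pos ha) hr).ne'
  refine (((h1.const_mul (1 / (2 * π))).const_add (1 / 4)).add h2).congr_deriv ?_
  rw [hroot]
  simp only [Pi.mul_apply]
  generalize √(1 + 2 * s ^ 2) = r at hr hsq
  field_simp
  rw [hsq]
  ring

/-- For a standard Gaussian `Z` and `s : ℝ`,
`E[Z²·Φ(s·Z)²] = 1/4 + (1/(2π))·arcsin(s²/(1+s²)) + s²/(π·(1+s²)·√(1+2s²))`. -/
theorem sq_cdf_sq_expectation (s : ℝ) :
    (∫ z : ℝ, z ^ 2 * (gcdf (s * z)) ^ 2 * gpdf z)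
    = 1 / 4 + (1 / (2 * Real.pi)) * Real.arcsin (s ^ 2 / (1 + s ^ 2))
      + s ^ 2 / (Real.pi * (1 + s ^ 2) * Real.sqrt (1 + 2 * s ^ 2)) := by
  have hd (t : ℝ) := (hasDerivAt_integral_sq_mul_gcdf_sq t).sub (hasDerivAt_arcsin_formula t)
  have h := is_const_of_deriv_eq_zero (fun t => (hd t).differentiableAt)
    (fun t => by rw [(hd t).deriv, sub_self]) s 0
  have h0 : ∫ z : ℝ, z ^ 2 * (gcdf (0 * z)) ^ 2 * gpdf z = 1 / 4 := by
    simp only [zero_mul, gcdf_zero, mul_right_comm _ ((1 / 2 : ℝ) ^ 2)]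
    rw [integral_mul_const, integral_sq_mul_gpdf]
    norm_num
  simp only [Pi.sub_apply] at h
  rw [h0] at h
  norm_num at h ⊢
  linarith
end

section
/- Fix N ∈ ℕ, Y ∈ ℝ^N, σ_n > 0 and C ∈ ℝ. For each L ∈ ℕ let k11_L, k22_L, k12_L ∈ ℝ, a_L, b_L ∈ ℝ^N and K_L an N×N real symmetric matrix such that the (N+2)×(N+2) block matrix with diagonal blocks (k11_L, k22_L, K_L), off-diagonal scalar k12_L, and cross blocks a_L (between index 1 and the N-block) and b_L (between index 2 and the N-block) is positive semidefinite. Suppose that as L → ∞: k11_L → C, k22_L → C, k12_L → C; a_L → d and b_L → d for a common vector d ∈ ℝ^N; and K_L → K entrywise for some matrix K. Define μ_L = (a_L − b_L)ᵀ (K_L + σ_n²·I)^{-1} Y and v_L = (k11_L + k22_L − 2·k12_L) − (a_L − b_L)ᵀ (K_L + σ_n²·I)^{-1} (a_L − b_L). Then μ_L → 0 and v_L → 0, and consequently the Gaussian measures with mean μ_L and variance max(v_L, 0) converge weakly to the Dirac measure at 0. (μ_L and v_L are the posterior predictive mean and variance of the difference of the GP posterior at two test points under Gaussian process regression with Gaussian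 likelihood of noise variance σ_n².) -/
open Real MeasureTheory Filter Topology ProbabilityTheory Matrix

theorem Matrix.PosSemidef.of_tendsto {n ι : Type*} [Fintype n] {l : Filter ι} [l.NeBot]
    {A : ι → Matrix n n ℝ} {B : Matrix n n ℝ} (hA : ∀ i, (A i).PosSemidef)
    (hAB : Tendsto A l (𝓝 B)) : B.PosSemidef := by
  refine .of_dotProduct_mulVec_nonneg ?_ fun x => ?_
  · have hT : Tendsto (fun i => (A i)ᴴ) l (𝓝 Bᴴ) :=
      (Continuous.matrix_conjTranspose continuous_id).continuousAt.tendsto.comp hAB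
    exact tendsto_nhds_unique (hT.congr fun i => (hA i).isHermitian) hAB
  · have hcont : Continuous fun M : Matrix n n ℝ => star x ⬝ᵥ (M *ᵥ x) :=
      continuous_const.dotProduct (continuous_id.matrix_mulVec continuous_const)
    exact ge_of_tendsto' ((hcont.tendsto B).comp hAB)
      fun i => (hA i).dotProduct_mulVec_nonneg x

theorem Matrix.PosDef.tendsto_inv {n ι : Type*} [Fintype n] [DecidableEq n] {l : Filter ι}
    {A : ι → Matrix n n ℝ} {B : Matrix n n ℝ} (hB : B.PosDef) (hAB : Tendsto A l (𝓝 B)) :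
    Tendsto (fun i => (A i)⁻¹) l (𝓝 B⁻¹) := by
  refine (continuousAt_matrix_inv B ?_).tendsto.comp hAB
  rw [Ring.inverse_eq_inv']
  exact continuousAt_inv₀ hB.det_pos.ne'

theorem Filter.Tendsto.dotProduct_mulVec {m n ι : Type*} [Fintype m] [Fintype n] {l : Filter ι}
    {u : ι → m → ℝ} {u₀ : m → ℝ} {A : ι → Matrix m n ℝ} {A₀ : Matrix m n ℝ}
    {w : ι → n → ℝ} {w₀ : n → ℝ} (hu : Tendsto u l (𝓝 u₀)) (hA : Tendsto A l (𝓝 A₀))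
    (hw : Tendsto w l (𝓝 w₀)) :
    Tendsto (fun i => u i ⬝ᵥ (A i *ᵥ w i)) l (𝓝 (u₀ ⬝ᵥ (A₀ *ᵥ w₀))) := by
  have hcont : Continuous fun p : (m → ℝ) × Matrix m n ℝ × (n → ℝ) => p.1 ⬝ᵥ (p.2.1 *ᵥ p.2.2) :=
    continuous_fst.dotProduct (continuous_snd.fst.matrix_mulVec continuous_snd.snd)
  exact (hcont.tendsto (u₀, A₀, w₀)).comp (hu.prodMk_nhds (hA.prodMk_nhds hw))

/-- Gaussian measures depend continuously, for weak convergence, on their mean and variance. -/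
theorem ProbabilityTheory.tendsto_integral_gaussianReal {m : ℕ → ℝ} {v : ℕ → NNReal}
    {m₀ : ℝ} {v₀ : NNReal} (hm : Tendsto m atTop (𝓝 m₀)) (hv : Tendsto v atTop (𝓝 v₀))
    (f : BoundedContinuousFunction ℝ ℝ) :
    Tendsto (fun k => ∫ x, f x ∂gaussianReal (m k) (v k)) atTop
      (𝓝 (∫ x, f x ∂gaussianReal m₀ v₀)) := by
  let P : ℝ → NNReal → ProbabilityMeasure ℝ := fun m v => ⟨gaussianReal m v, inferInstance⟩
  have hP : Tendsto (fun k => P (m k) (v k)) atTop (𝓝 (P m₀ v₀)) := by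
    refine ProbabilityMeasure.tendsto_of_tendsto_charFun fun t => ?_
    have hcont : Continuous fun p : ℝ × NNReal =>
        Complex.exp (t * p.1 * Complex.I - (p.2 : ℝ) * t ^ 2 / 2) := by fun_prop
    simpa [P, charFun_gaussianReal, Function.comp_def] using
      (hcont.tendsto (m₀, v₀)).comp (hm.prodMk_nhds hv)
  exact ProbabilityMeasure.tendsto_iff_forall_integral_tendsto.mp hP f

/-- Degenerate limiting posterior.  Under the stated convergence of the blocks of the
PSD covariance structure (two test points with variances `k11 L`, `k22 L`, covariance
`k12 L`, cross-covariances `a L`, `b L` with the `N` training points, and training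
covariance matrix `Kseq L`), the posterior predictive mean
`μ_L = (a_L − b_L)ᵀ(K_L + σ_n²·I)⁻¹Y` and variance
`v_L = (k11_L + k22_L − 2·k12_L) − (a_L − b_L)ᵀ(K_L + σ_n²·I)⁻¹(a_L − b_L)` of the
difference of the GP posterior at the two test points both converge to `0`, and the
Gaussian measures with mean `μ_L` and variance `max(v_L, 0)` converge weakly to the
Dirac measure at `0`. -/
theorem degenerate_posterior (N : ℕ) (Y : Fin N → ℝ) (σn : ℝ) (hσn : 0 < σn) (C : ℝ)
    (k11 k22 k12 : ℕ → ℝ) (a b : ℕ → Fin N → ℝ)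
    (Kseq : ℕ → Matrix (Fin N) (Fin N) ℝ)
    (hsymm : ∀ L, (Kseq L).IsSymm)
    (hpsd : ∀ L, (Matrix.fromBlocks
        !![k11 L, k12 L; k12 L, k22 L]
        (Matrix.of fun i j => if i = (0 : Fin 2) then a L j else b L j)
        (Matrix.of fun i j => if j = (0 : Fin 2) then a L i else b L i)
        (Kseq L)).PosSemidef)
    (d : Fin N → ℝ) (K : Matrix (Fin N) (Fin N) ℝ)
    (hk11 : Tendsto k11 atTop (𝓝 C))
    (hk22 : Tendsto k22 atTop (𝓝 C))
    (hk12 : Tendsto k12 atTop (𝓝 C))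
    (ha : ∀ i, Tendsto (fun L => a L i) atTop (𝓝 (d i)))
    (hb : ∀ i, Tendsto (fun L => b L i) atTop (𝓝 (d i)))
    (hK : ∀ i j, Tendsto (fun L => Kseq L i j) atTop (𝓝 (K i j))) :
    Tendsto (fun L => (a L - b L) ⬝ᵥ ((Kseq L + σn ^ 2 • 1)⁻¹ *ᵥ Y)) atTop (𝓝 0) ∧
    Tendsto (fun L => (k11 L + k22 L - 2 * k12 L) -
        (a L - b L) ⬝ᵥ ((Kseq L + σn ^ 2 • 1)⁻¹ *ᵥ (a L - b L))) atTop (𝓝 0) ∧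
    ∀ f : BoundedContinuousFunction ℝ ℝ,
      Tendsto
        (fun L : ℕ => ∫ x : ℝ, f x ∂(gaussianReal
          ((a L - b L) ⬝ᵥ ((Kseq L + σn ^ 2 • 1)⁻¹ *ᵥ Y))
          (((k11 L + k22 L - 2 * k12 L) -
            (a L - b L) ⬝ᵥ ((Kseq L + σn ^ 2 • 1)⁻¹ *ᵥ (a L - b L))).toNNReal)))
        atTop
        (𝓝 (∫ x : ℝ, f x ∂(Measure.dirac (0 : ℝ)))) := by
  have hdiff : Tendsto (fun L => a L - b L) atTop (𝓝 0) := by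
    simpa using (tendsto_pi_nhds.mpr ha).sub (tendsto_pi_nhds.mpr hb)
  have hKlim : Tendsto Kseq atTop (𝓝 K) :=
    tendsto_pi_nhds.mpr fun i => tendsto_pi_nhds.mpr (hK i)
  have hKpsd : K.PosSemidef :=
    .of_tendsto (fun L => (hpsd L).submatrix Sum.inr) hKlim
  have hinv : Tendsto (fun L => (Kseq L + σn ^ 2 • (1 : Matrix (Fin N) (Fin N) ℝ))⁻¹) atTop
      (𝓝 (K + σn ^ 2 • (1 : Matrix (Fin N) (Fin N) ℝ))⁻¹) :=
    (PosDef.posSemidef_add hKpsd (PosDef.one.smul (by positivity))).tendsto_inv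
      (hKlim.add_const _)
  have hmean : Tendsto (fun L => (a L - b L) ⬝ᵥ ((Kseq L + σn ^ 2 • 1)⁻¹ *ᵥ Y)) atTop (𝓝 0) := by
    simpa using hdiff.dotProduct_mulVec hinv (tendsto_const_nhds (x := Y))
  have hvar : Tendsto (fun L => (k11 L + k22 L - 2 * k12 L) -
      (a L - b L) ⬝ᵥ ((Kseq L + σn ^ 2 • 1)⁻¹ *ᵥ (a L - b L))) atTop (𝓝 0) := by
    have h := ((hk11.add hk22).sub (hk12.const_mul 2)).sub (hdiff.dotProduct_mulVec hinv hdiff)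
    rwa [zero_dotProduct, sub_zero, ← two_mul, sub_self] at h
  refine ⟨hmean, hvar, fun f => ?_⟩
  rw [← gaussianReal_zero_var]
  refine tendsto_integral_gaussianReal hmean ?_ f
  simpa only [toNNReal_zero, Function.comp_def] using (continuous_real_toNNReal.tendsto 0).comp hvar
end

section
/- Let ρ ∈ [-1,1] and a ∈ ℝ, and write θ = arccos ρ. Then E[ (1{Z1 > 0} + a·1{Z1 < 0}) · (1{Z2 > 0} + a·1{Z2 < 0}) ] = (1−a)²·(π − θ)/(2π) + a. -/
open Real MeasureTheory

/-- The almost-everywhere derivative of the leaky ReLU activation with slope `a`. -/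
noncomputable def leakyStep (a z : ℝ) : ℝ :=
  (if 0 < z then (1 : ℝ) else 0) + a * (if z < 0 then (1 : ℝ) else 0)

lemma leakyStep_of_pos (a : ℝ) {z : ℝ} (hz : 0 < z) : leakyStep a z = 1 := by
  simp [leakyStep, hz, hz.not_gt]

lemma leakyStep_of_neg (a : ℝ) {z : ℝ} (hz : z < 0) : leakyStep a z = a := by
  simp [leakyStep, hz, hz.not_gt]

lemma leakyStep_mul (a : ℝ) {r : ℝ} (hr : 0 < r) (z : ℝ) :
    leakyStep a (r * z) = leakyStep a z := by
  simp [leakyStep, mul_pos_iff_of_pos_left hr, mul_neg_iff, hr, hr.not_gt]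

lemma measurable_leakyStep (a : ℝ) : Measurable (leakyStep a) :=
  (Measurable.ite measurableSet_Ioi measurable_const measurable_const).add
    ((Measurable.ite measurableSet_Iio measurable_const measurable_const).const_mul a)

lemma abs_leakyStep_le (a z : ℝ) : |leakyStep a z| ≤ 1 + |a| := by
  rcases lt_trichotomy z 0 with h | rfl | h
  · simp [leakyStep_of_neg a h]
  · simpa [leakyStep] using by positivity
  · simp [leakyStep_of_pos a h]

lemma gpdf_mul_gpdf_polar (r t : ℝ) :
    gpdf (r * cos t) * gpdf (r * sin t) = (2 * π)⁻¹ * exp (-(r ^ 2) / 2) := by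
  have hs : (√(2 * π))⁻¹ * (√(2 * π))⁻¹ = (2 * π)⁻¹ := by
    rw [← mul_inv, mul_self_sqrt (by positivity)]
  have he : exp (-((r * cos t) ^ 2) / 2) * exp (-((r * sin t) ^ 2) / 2) = exp (-(r ^ 2) / 2) := by
    rw [← exp_add]
    congr 1
    linear_combination (-(r ^ 2) / 2) * sin_sq_add_cos_sq t
  rw [gpdf, gpdf, mul_mul_mul_comm, hs, he]

lemma integral_Ioi_mul_exp_neg_sq_div_two :
    ∫ r in Set.Ioi (0 : ℝ), r * exp (-(r ^ 2) / 2) = 1 := by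
  have h := integral_rpow_mul_exp_neg_mul_rpow (p := 2) (q := 1) (b := 1 / 2)
    (by norm_num) (by norm_num) (by norm_num)
  norm_num [rpow_neg_one] at h
  rw [← h]
  refine setIntegral_congr_fun measurableSet_Ioi fun r _ => ?_
  congr 2
  ring

lemma intervalIntegrable_of_eqOn_const {f : ℝ → ℝ} {c u v : ℝ} (huv : u ≤ v)
    (hf : ∀ t ∈ Set.Ioo u v, f t = c) : IntervalIntegrable f volume u v := by
  rw [intervalIntegrable_iff_integrableOn_Ioo_of_le huv]
  exact (integrableOn_const (by simp)).congr_fun (fun t ht => (hf t ht).symm) measurableSet_Ioo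

lemma intervalIntegral_of_eqOn_const {f : ℝ → ℝ} {c u v : ℝ} (huv : u ≤ v)
    (hf : ∀ t ∈ Set.Ioo u v, f t = c) : ∫ t in u..v, f t = (v - u) * c := by
  rw [intervalIntegral.integral_of_le huv, integral_Ioc_eq_integral_Ioo,
    setIntegral_congr_fun measurableSet_Ioo hf]
  simp [huv]

lemma integral_leakyStep_cos_mul (a : ℝ) {θ : ℝ} (h0 : 0 ≤ θ) (hπ : θ ≤ π) :
    ∫ t in Set.Ioo (-π) π, leakyStep a (cos t) * leakyStep a (cos (t - θ)) =
      (1 - a) ^ 2 * (π - θ) + 2 * π * a := by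
  set f : ℝ → ℝ := fun t => leakyStep a (cos t) * leakyStep a (cos (t - θ)) with hf
  have hper : Function.Periodic f (2 * π) := fun t => by
    simp only [hf, cos_add_two_pi, add_sub_right_comm t (2 * π) θ]
  have neg_of {s : ℝ} (h₁ : π / 2 < s) (h₂ : s < 3 * π / 2) : leakyStep a (cos s) = a :=
    leakyStep_of_neg a (cos_neg_of_pi_div_two_lt_of_lt h₁ (by linarith))
  have pos_of {s : ℝ} (h₁ : -(π / 2) < s) (h₂ : s < π / 2) : leakyStep a (cos s) = 1 :=
    leakyStep_of_pos a (cos_pos_of_mem_Ioo ⟨h₁, h₂⟩)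
  have neg_of' {s : ℝ} (h₁ : -(3 * π / 2) < s) (h₂ : s < -(π / 2)) :
      leakyStep a (cos s) = a := by
    rw [← cos_neg]
    exact neg_of (by linarith) (by linarith)
  have f₁ : ∀ t ∈ Set.Ioo (-(π / 2)) (θ - π / 2), f t = a := fun t ⟨h₁, h₂⟩ => by
    simp only [hf]
    rw [pos_of (by linarith) (by linarith), neg_of' (by linarith) (by linarith), one_mul]
  have f₂ : ∀ t ∈ Set.Ioo (θ - π / 2) (π / 2), f t = 1 := fun t ⟨h₁, h₂⟩ => by
    simp only [hf]
    rw [pos_of (by linarith) (by linarith), pos_of (by linarith) (by linarith), one_mul]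
  have f₃ : ∀ t ∈ Set.Ioo (π / 2) (θ + π / 2), f t = a := fun t ⟨h₁, h₂⟩ => by
    simp only [hf]
    rw [neg_of (by linarith) (by linarith), pos_of (by linarith) (by linarith), mul_one]
  have f₄ : ∀ t ∈ Set.Ioo (θ + π / 2) (3 * π / 2), f t = a * a := fun t ⟨h₁, h₂⟩ => by
    simp only [hf]
    rw [neg_of (by linarith) (by linarith), neg_of (by linarith) (by linarith)]
  have l₁ : -(π / 2) ≤ θ - π / 2 := by linarith
  have l₂ : θ - π / 2 ≤ π / 2 := by linarith
  have l₃ : π / 2 ≤ θ + π / 2 := by linarith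
  have l₄ : θ + π / 2 ≤ 3 * π / 2 := by linarith
  have i₁ := intervalIntegrable_of_eqOn_const l₁ f₁
  have i₂ := intervalIntegrable_of_eqOn_const l₂ f₂
  have i₃ := intervalIntegrable_of_eqOn_const l₃ f₃
  have i₄ := intervalIntegrable_of_eqOn_const l₄ f₄
  have hshift := hper.intervalIntegral_add_eq (-π) (-(π / 2))
  rw [show -π + 2 * π = π by ring, show -(π / 2) + 2 * π = 3 * π / 2 by ring] at hshift
  rw [← integral_Ioc_eq_integral_Ioo, ← intervalIntegral.integral_of_le (by linarith [pi_pos]),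
    hshift, ← intervalIntegral.integral_add_adjacent_intervals ((i₁.trans i₂).trans i₃) i₄,
    ← intervalIntegral.integral_add_adjacent_intervals (i₁.trans i₂) i₃,
    ← intervalIntegral.integral_add_adjacent_intervals i₁ i₂,
    intervalIntegral_of_eqOn_const l₁ f₁, intervalIntegral_of_eqOn_const l₂ f₂,
    intervalIntegral_of_eqOn_const l₃ f₃, intervalIntegral_of_eqOn_const l₄ f₄]
  ring

lemma integrable_leakyStep_mul_gpdf (a c s : ℝ) :
    Integrable (fun p : ℝ × ℝ =>
      leakyStep a p.1 * leakyStep a (c * p.1 + s * p.2) * gpdf p.1 * gpdf p.2) := by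
  have hm : Measurable fun p : ℝ × ℝ => leakyStep a p.1 * leakyStep a (c * p.1 + s * p.2) :=
    ((measurable_leakyStep a).comp measurable_fst).mul
      ((measurable_leakyStep a).comp (by fun_prop))
  have h := (integrable_gpdf.mul_prod integrable_gpdf).bdd_mul (c := (1 + |a|) * (1 + |a|))
    hm.aestronglyMeasurable (.of_forall fun p => by
      rw [norm_mul]
      exact mul_le_mul (abs_leakyStep_le _ _) (abs_leakyStep_le _ _) (norm_nonneg _)
        (by positivity))
  simpa only [mul_assoc, Measure.volume_eq_prod] using h

/-- For a centered bivariate Gaussian pair `(Z₁, Z₂)` with unit variances and correlation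
`ρ ∈ [-1,1]` (realised as `Z₁ = x`, `Z₂ = ρ·x + √(1−ρ²)·y` for independent standard
Gaussians `x, y`), `a : ℝ` and `θ = arccos ρ`:
`E[(1{Z₁>0} + a·1{Z₁<0})·(1{Z₂>0} + a·1{Z₂<0})] = (1−a)²·(π − θ)/(2π) + a`. -/
theorem lrelu_deriv_expectation (ρ a : ℝ) (hρ : ρ ∈ Set.Icc (-1 : ℝ) 1) :
    (∫ x : ℝ, ∫ y : ℝ,
        ((if 0 < x then (1 : ℝ) else 0) + a * (if x < 0 then (1 : ℝ) else 0)) *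
        ((if 0 < ρ * x + Real.sqrt (1 - ρ ^ 2) * y then (1 : ℝ) else 0) +
          a * (if ρ * x + Real.sqrt (1 - ρ ^ 2) * y < 0 then (1 : ℝ) else 0)) *
        gpdf x * gpdf y)
    = (1 - a) ^ 2 * (Real.pi - Real.arccos ρ) / (2 * Real.pi) + a := by
  set θ := arccos ρ
  have hc : ρ = cos θ := (cos_arccos hρ.1 hρ.2).symm
  have hs : √(1 - ρ ^ 2) = sin θ := (sin_arccos ρ).symm
  have hint := integrable_leakyStep_mul_gpdf a (cos θ) (sin θ)
  rw [hs, hc]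
  change ∫ x, ∫ y, leakyStep a x * leakyStep a (cos θ * x + sin θ * y) * gpdf x * gpdf y = _
  rw [integral_integral hint, ← Measure.volume_eq_prod, ← integral_comp_polarCoord_symm,
    polarCoord_target]
  have hpolar : ∀ p ∈ Set.Ioi (0 : ℝ) ×ˢ Set.Ioo (-π) π,
      p.1 • (leakyStep a (polarCoord.symm p).1 *
        leakyStep a (cos θ * (polarCoord.symm p).1 + sin θ * (polarCoord.symm p).2) *
        gpdf (polarCoord.symm p).1 * gpdf (polarCoord.symm p).2) =
      (p.1 * exp (-(p.1 ^ 2) / 2)) *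
        ((2 * π)⁻¹ * (leakyStep a (cos p.2) * leakyStep a (cos (p.2 - θ)))) := by
    rintro ⟨r, t⟩ ⟨hr, -⟩
    have hr : 0 < r := hr
    simp only [polarCoord_symm_apply, smul_eq_mul]
    rw [show cos θ * (r * cos t) + sin θ * (r * sin t) = r * cos (t - θ) by
      rw [cos_sub]; ring, leakyStep_mul a hr, leakyStep_mul a hr, mul_assoc _ (gpdf _),
      gpdf_mul_gpdf_polar]
    ring
  rw [setIntegral_congr_fun (measurableSet_Ioi.prod measurableSet_Ioo) hpolar,
    Measure.volume_eq_prod,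
    setIntegral_prod_mul (fun r : ℝ => r * exp (-(r ^ 2) / 2))
      (fun t => (2 * π)⁻¹ * (leakyStep a (cos t) * leakyStep a (cos (t - θ)))),
    integral_Ioi_mul_exp_neg_sq_div_two, integral_const_mul,
    integral_leakyStep_cos_mul a (arccos_nonneg ρ) (arccos_le_pi ρ)]
  change 1 * ((2 * π)⁻¹ * ((1 - a) ^ 2 * (π - θ) + 2 * π * a)) = _
  field_simp
end

section
/- Fix a ∈ [0,1) and define κ_a : [-1,1] → ℝ by κ_a(ρ) = [ (1−a)² · ( √(1−ρ²) + (π − arccos ρ)·ρ ) / (2π) + a·ρ ] / ( (1+a²)/2 ). Then κ_a maps [-1,1] into [-1,1], κ_a(1) = 1, ρ = 1 is the unique fixed point of κ_a in [-1,1], and for every ρ ∈ [-1,1] the iterates κ_a^n(ρ) converge to 1 as n → ∞. (κ_a is the normalised kernel map of one layer of an infinitely wide leaky-ReLU network with slope a, zero-mean iid weights and zero bias variance; hence the depth-L normalised kernel converges to the constant 1 and the infinitely deep prior is degenerate on any hypersphere.) -/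
open Real Filter Topology

/-- `sin θ - θ cos θ > 0` on `(0, π]`. -/
theorem mul_cos_lt_sin {θ : ℝ} (h0 : 0 < θ) (hπ : θ ≤ π) : θ * cos θ < sin θ := by
  rcases lt_or_ge θ (π / 2) with h | h
  · have hc : 0 < cos θ := cos_pos_of_mem_Ioo ⟨by linarith, h⟩
    have ht := lt_tan h0 h
    rwa [tan_eq_sin_div_cos, lt_div_iff₀ hc] at ht
  · rcases hπ.lt_or_eq with h' | rfl
    · have hc : cos θ ≤ 0 := cos_nonpos_of_pi_div_two_le_of_le h (by linarith)
      have hs : 0 < sin θ := sin_pos_of_pos_of_lt_pi h0 h'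
      nlinarith
    · simp [pi_pos]

theorem mul_arccos_lt_sqrt {ρ : ℝ} (h1 : -1 ≤ ρ) (h2 : ρ < 1) :
    ρ * arccos ρ < √(1 - ρ ^ 2) := by
  have h := mul_cos_lt_sin (arccos_pos.2 h2) (arccos_le_pi ρ)
  rw [cos_arccos h1 h2.le, sin_arccos] at h
  linarith

theorem sqrt_add_pi_sub_arccos_mul_le_pi {ρ : ℝ} (h2 : ρ ≤ 1) :
    √(1 - ρ ^ 2) + (π - arccos ρ) * ρ ≤ π := by
  have hs := sin_le (arccos_nonneg ρ)
  rw [sin_arccos] at hs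
  nlinarith [arccos_le_pi ρ]

/-- A continuous self-map of `[b, c]` lying strictly above the diagonal on `[b, c)` has all its
iterates converging to `c`. -/
theorem tendsto_iterate_of_lt_map {f : ℝ → ℝ} {b c : ℝ} (hf : Continuous f)
    (hmaps : Set.MapsTo f (Set.Icc b c) (Set.Icc b c))
    (hc : f c = c) (hlt : ∀ x, b ≤ x → x < c → x < f x) {x : ℝ} (hx : x ∈ Set.Icc b c) :
    Tendsto (fun n : ℕ => f^[n] x) atTop (𝓝 c) := by
  have hmem (n : ℕ) : f^[n] x ∈ Set.Icc b c := hmaps.iterate n hx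
  have hmono : Monotone (fun n : ℕ => f^[n] x) := by
    refine monotone_nat_of_le_succ fun n => ?_
    rw [Function.iterate_succ_apply']
    rcases (hmem n).2.lt_or_eq with h | h
    · exact (hlt _ (hmem n).1 h).le
    · rw [h, hc]
  have hbdd : BddAbove (Set.range fun n : ℕ => f^[n] x) :=
    ⟨c, Set.forall_mem_range.2 fun n => (hmem n).2⟩
  have hlim := tendsto_atTop_ciSup hmono hbdd
  have hL := isClosed_Icc.mem_of_tendsto hlim (Eventually.of_forall hmem)
  have hfix := isFixedPt_of_tendsto_iterate hlim hf.continuousAt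
  rcases hL.2.lt_or_eq with h | h
  · exact absurd hfix.eq (hlt _ hL.1 h).ne'
  · rwa [h] at hlim

/-- The normalised kernel map `κ_a` of one layer of an infinitely wide leaky-ReLU network
with slope `a ∈ [0,1)`, zero-mean iid weights and zero bias variance:
`κ_a(ρ) = [(1−a)²·(√(1−ρ²) + (π − arccos ρ)·ρ)/(2π) + a·ρ] / ((1+a²)/2)`.
It maps `[-1,1]` into `[-1,1]`, fixes `1`, has `ρ = 1` as its unique fixed point in
`[-1,1]`, and all its iterates converge to `1`; hence the infinitely deep prior is
degenerate on any hypersphere. -/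
theorem lrelu_kernel_map_degenerate (a : ℝ) (ha : a ∈ Set.Ico (0 : ℝ) 1)
    (κ : ℝ → ℝ)
    (hκ : ∀ ρ : ℝ, κ ρ =
      ((1 - a) ^ 2 * (Real.sqrt (1 - ρ ^ 2) + (Real.pi - Real.arccos ρ) * ρ) /
          (2 * Real.pi) + a * ρ) / ((1 + a ^ 2) / 2)) :
    Set.MapsTo κ (Set.Icc (-1 : ℝ) 1) (Set.Icc (-1 : ℝ) 1) ∧
    κ 1 = 1 ∧
    (∀ ρ ∈ Set.Icc (-1 : ℝ) 1, κ ρ = ρ → ρ = 1) ∧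
    (∀ ρ ∈ Set.Icc (-1 : ℝ) 1, Tendsto (fun n : ℕ => κ^[n] ρ) atTop (𝓝 1)) := by
  have hd : 0 < 1 + a ^ 2 := by positivity
  have ha1 : 0 < (1 - a) ^ 2 := by have := ha.2; apply pow_pos; linarith
  have hκ_add (ρ : ℝ) : κ ρ =
      ρ + (1 - a) ^ 2 / (π * (1 + a ^ 2)) * (√(1 - ρ ^ 2) - ρ * arccos ρ) := by
    rw [hκ]
    have := pi_ne_zero
    field_simp
    ring
  have hone : κ 1 = 1 := by simp [hκ_add]
  have hlt (ρ : ℝ) (h1 : -1 ≤ ρ) (h2 : ρ < 1) : ρ < κ ρ := by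
    rw [hκ_add]
    have := sub_pos.2 (mul_arccos_lt_sqrt h1 h2)
    have : 0 < (1 - a) ^ 2 / (π * (1 + a ^ 2)) * (√(1 - ρ ^ 2) - ρ * arccos ρ) := by positivity
    linarith
  have hle (ρ : ℝ) (h2 : ρ ≤ 1) : κ ρ ≤ 1 := by
    have hJ : (√(1 - ρ ^ 2) + (π - arccos ρ) * ρ) / (2 * π) ≤ 1 / 2 := by
      rw [div_le_div_iff₀ (by positivity) two_pos]
      linarith [sqrt_add_pi_sub_arccos_mul_le_pi h2]
    rw [hκ, div_le_one (by positivity), mul_div_assoc]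
    nlinarith [mul_le_mul_of_nonneg_left hJ ha1.le, mul_le_mul_of_nonneg_left h2 ha.1]
  have hmaps : Set.MapsTo κ (Set.Icc (-1 : ℝ) 1) (Set.Icc (-1 : ℝ) 1) := by
    refine fun ρ hρ => ⟨?_, hle ρ hρ.2⟩
    rcases hρ.2.lt_or_eq with h | rfl
    · exact hρ.1.trans (hlt ρ hρ.1 h).le
    · rw [hone]; norm_num
  have hcont : Continuous κ := by
    rw [funext hκ_add]
    have := continuous_arccos
    fun_prop
  refine ⟨hmaps, hone, fun ρ hρ hfix => ?_, fun ρ hρ =>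
    tendsto_iterate_of_lt_map hcont hmaps hone hlt hρ⟩
  by_contra hne
  exact (hlt ρ hρ.1 (hρ.2.lt_of_ne hne)).ne' hfix
end
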